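/- The language {aⁿbⁿcⁿ : n ≥ 1} is the control language of some labeled flat splicing system of type (3, 1) with finite initial set; that is, {aⁿbⁿcⁿ : n ≥ 1} ∈ CLLS^3_{1,FIN}. -/

import Mathlib

/-- A flat splicing rule `⟨α | γ−δ | β⟩`. -/
structure FlatRule (A : Type) where
  /-- left handle α -/
  lf : List A
  /-- right handle β -/
  rt : List A
  /-- first letter γ of the inserted word (a word of length ≤ 1) -/
  ins1 : List A
  /-- last letter δ of the inserted word (a word of length ≤ 1) -/
  ins2 : List A

/-- Application of a flat splicing rule: from `u = x·α·β·y` and `v = γ·z·δ` (with `|v| ≥ 1`)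
produce `w = x·α·v·β·y`. -/
def FlatRule.Splice {A : Type} (r : FlatRule A) (u v w : List A) : Prop :=
  ∃ x y z : List A,
    u = x ++ r.lf ++ r.rt ++ y ∧
    v = r.ins1 ++ z ++ r.ins2 ∧ 1 ≤ v.length ∧
    w = x ++ r.lf ++ v ++ r.rt ++ y

/-- A labeled flat splicing system `(A, I, R, Lab)`; every rule carries a label word over `Λ`
(a single letter for Szilard/control labelings, possibly the empty word for λ-labelings). -/
structure LabeledFSS (A Λ : Type) where
  I : Set (List A)
  R : Set (FlatRule A)
  lab : FlatRule A → List Λ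
  finR : R.Finite
  insBound : ∀ r ∈ R, r.ins1.length ≤ 1 ∧ r.ins2.length ≤ 1

namespace LabeledFSS

variable {A Λ : Type} (S : LabeledFSS A Λ)

/-- Some rule of the system is applicable to the word `u` (together with some initial word). -/
def Applicable (u : List A) : Prop :=
  ∃ r ∈ S.R, ∃ v ∈ S.I, ∃ w, r.Splice u v w

/-- `S.Deriv x ls` : starting from initial words, the word `x` is derivable with label word `ls`. -/
inductive Deriv : List A → List Λ → Prop
  | start {x₀ y₀ x₁ : List A} {r : FlatRule A} :
      x₀ ∈ S.I → y₀ ∈ S.I → r ∈ S.R → r.Splice x₀ y₀ x₁ → Deriv x₁ (S.lab r)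
  | step {x y w : List A} {ls : List Λ} {r : FlatRule A} :
      Deriv x ls → y ∈ S.I → r ∈ S.R → r.Splice x y w → Deriv w (ls ++ S.lab r)

/-- The derivation language (Szilard language resp. control language) of the system:
label words of terminal derivations. -/
def derLang : Language Λ :=
  { ls | ∃ x : List A, S.Deriv x ls ∧ ¬ S.Applicable x }

/-- The system has type `(m, n)`: `m` is the maximum length of the handles `α, β`
and `n` is the maximum length of `γδ` over all rules. -/
def HasType (m n : ℕ) : Prop :=
  (∀ r ∈ S.R, r.lf.length ≤ m ∧ r.rt.length ≤ m) ∧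
  (∃ r ∈ S.R, r.lf.length = m ∨ r.rt.length = m) ∧
  (∀ r ∈ S.R, r.ins1.length + r.ins2.length ≤ n) ∧
  (∃ r ∈ S.R, r.ins1.length + r.ins2.length = n)

/-- Szilard labeling: each rule is labeled by a single letter, in a one-to-one manner. -/
def SzilardLabeled : Prop :=
  (∀ r ∈ S.R, (S.lab r).length = 1) ∧ Set.InjOn S.lab S.R

/-- Control labeling: each rule is labeled by a single letter
(distinct rules may share a label). -/
def ControlLabeled : Prop :=
  ∀ r ∈ S.R, (S.lab r).length = 1

/-- λ-control labeling: each rule is labeled by a single letter or by the empty word. -/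
def LambdaControlLabeled : Prop :=
  ∀ r ∈ S.R, (S.lab r).length ≤ 1

end LabeledFSS

/-- A three-letter alphabet `{a, b, c}`. -/
inductive ABC : Type
  | a
  | b
  | c
deriving DecidableEq

namespace CountingSystem

/-- Working alphabet: end markers `L`, `R`, cells `X`, and the marks `B`, `C` put on cells. -/
inductive Letter : Type
  | L
  | R
  | X
  | B
  | C
deriving DecidableEq

open Letter

instance : Fintype Letter := ⟨{L, R, X, B, C}, by rintro (_ | _) <;> decide⟩

/-- The splicing system: `L R` is filled with cells, which are then marked by `B` from right to
left and by `C` from left to right. -/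
def sys : LabeledFSS Letter ABC where
  I := {[L, R], [X], [B], [C]}
  R := {⟨[L], [R], [X], []⟩, ⟨[X], [R], [X], []⟩, ⟨[X], [R], [B], []⟩,
    ⟨[X], [X, B], [B], []⟩, ⟨[L], [X, B], [C], []⟩, ⟨[C, X, B], [X, B], [C], []⟩}
  lab r := match r.ins1 with
    | [B] => [ABC.b]
    | [C] => [ABC.c]
    | _ => [ABC.a]
  finR := by simp
  insBound := by simp

/-- One splicing step of `sys`, together with its label. -/
inductive Ins : List Letter → ABC → List Letter → Prop
  | aFirst (t) : Ins (L :: R :: t) ABC.a (L :: X :: R :: t)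
  | aNext (t) : Ins (X :: R :: t) ABC.a (X :: X :: R :: t)
  | bFirst (t) : Ins (X :: R :: t) ABC.b (X :: B :: R :: t)
  | bNext (t) : Ins (X :: X :: B :: t) ABC.b (X :: B :: X :: B :: t)
  | cFirst (t) : Ins (L :: X :: B :: t) ABC.c (L :: C :: X :: B :: t)
  | cNext (t) : Ins (C :: X :: B :: X :: B :: t) ABC.c (C :: X :: B :: C :: X :: B :: t)
  | cons (h) {u l w} : Ins u l w → Ins (h :: u) l (h :: w)

theorem Ins.append (x : List Letter) {u w : List Letter} {l : ABC} (h : Ins u l w) :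
    Ins (x ++ u) l (x ++ w) := by
  induction x with
  | nil => exact h
  | cons a x ih => exact ih.cons a

theorem ins_of_splice {r : FlatRule Letter} {u v w : List Letter} (hr : r ∈ sys.R) (hv : v ∈ sys.I)
    (h : r.Splice u v w) : ∃ l, sys.lab r = [l] ∧ Ins u l w := by
  obtain ⟨x, y, z, rfl, hz, -, rfl⟩ := h
  simp only [sys, Set.mem_insert_iff, Set.mem_singleton_iff] at hr hv
  rcases hr with rfl | rfl | rfl | rfl | rfl | rfl <;>
    rcases hv with rfl | rfl | rfl | rfl <;> simp at hz <;>
    refine ⟨_, rfl, ?_⟩ <;> simp only [List.append_assoc] <;> apply Ins.append <;> constructor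

theorem splice_of_ins {u w : List Letter} {l : ABC} (h : Ins u l w) :
    ∃ r ∈ sys.R, ∃ v ∈ sys.I, sys.lab r = [l] ∧ r.Splice u v w := by
  induction h with
  | aFirst t => exact ⟨⟨[L], [R], [X], []⟩, by simp [sys], [X], by simp [sys], rfl, [], t, [],
      by simp⟩
  | aNext t => exact ⟨⟨[X], [R], [X], []⟩, by simp [sys], [X], by simp [sys], rfl, [], t, [],
      by simp⟩
  | bFirst t => exact ⟨⟨[X], [R], [B], []⟩, by simp [sys], [B], by simp [sys], rfl, [], t, [],
      by simp⟩
  | bNext t => exact ⟨⟨[X], [X, B], [B], []⟩, by simp [sys], [B], by simp [sys], rfl, [], t, [],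
      by simp⟩
  | cFirst t => exact ⟨⟨[L], [X, B], [C], []⟩, by simp [sys], [C], by simp [sys], rfl, [], t, [],
      by simp⟩
  | cNext t => exact ⟨⟨[C, X, B], [X, B], [C], []⟩, by simp [sys], [C], by simp [sys], rfl,
      [], t, [], by simp⟩
  | cons a _ ih =>
    obtain ⟨r, hr, v, hv, hl, x, y, z, rfl, hz, h1, rfl⟩ := ih
    exact ⟨r, hr, v, hv, hl, a :: x, y, z, by simp, hz, h1, by simp⟩

theorem applicable_iff {u : List Letter} : sys.Applicable u ↔ ∃ l w, Ins u l w := by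
  constructor
  · rintro ⟨r, hr, v, hv, w, h⟩
    obtain ⟨l, -, hi⟩ := ins_of_splice hr hv h
    exact ⟨l, w, hi⟩
  · rintro ⟨l, w, h⟩
    obtain ⟨r, hr, v, hv, -, hs⟩ := splice_of_ins h
    exact ⟨r, hr, v, hv, w, hs⟩

theorem deriv_step {u w : List Letter} {l : ABC} {ls : List ABC} (hu : sys.Deriv u ls)
    (h : Ins u l w) : sys.Deriv w (ls ++ [l]) := by
  obtain ⟨r, hr, v, hv, hl, hs⟩ := splice_of_ins h
  exact hl ▸ hu.step hv hr hs

/-- `k` cells marked by `B`, then the right end. -/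
def bCells : ℕ → List Letter
  | 0 => [R]
  | k + 1 => X :: B :: bCells k

/-- `j` unmarked cells followed by `bCells k`. -/
def xCells : ℕ → ℕ → List Letter
  | 0, k => bCells k
  | j + 1, k => X :: xCells j k

/-- `i` fully marked cells followed by `xCells j k`. -/
def cCells : ℕ → ℕ → ℕ → List Letter
  | 0, j, k => xCells j k
  | i + 1, j, k => C :: X :: B :: cCells i j k

/-- Labels produced on the way to `L :: cCells i j k`. -/
def word (i j k : ℕ) : List ABC :=
  List.replicate (i + j + k) ABC.a ++ List.replicate (i + k) ABC.b ++ List.replicate i ABC.c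

theorem not_ins_bCells {k : ℕ} {l : ABC} {w : List Letter} : ¬ Ins (bCells k) l w := by
  induction k generalizing w with
  | zero => rintro (_ | _ | _ | _ | _ | _ | ⟨_, ⟨⟩⟩)
  | succ k ih =>
    intro h
    rcases h with _ | _ | _ | _ | _ | _ | ⟨_, h⟩
    rcases h with _ | _ | _ | _ | _ | _ | ⟨_, h⟩
    exact ih h

theorem ins_xCells {j k : ℕ} {l : ABC} {w : List Letter} (h : Ins (xCells j k) l w) :
    ∃ m, j = m + 1 ∧ (k = 0 ∧ l = ABC.a ∧ w = xCells (m + 2) 0 ∨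
      l = ABC.b ∧ w = xCells m (k + 1)) := by
  induction j generalizing w with
  | zero => exact (not_ins_bCells h).elim
  | succ j ih =>
    refine ⟨j, rfl, ?_⟩
    rcases j with _ | _ | j <;> rcases k with _ | k <;>
      simp only [xCells, bCells] at h <;>
      rcases h with _ | _ | _ | _ | _ | _ | ⟨_, h⟩ <;>
      first
      | simp [xCells, bCells]; done
      | (obtain ⟨m, hm, ⟨hk, rfl, rfl⟩ | ⟨rfl, rfl⟩⟩ := ih h <;> cases hm <;>
          simp_all [xCells, bCells])

theorem ins_L_xCells {j k : ℕ} {l : ABC} {w : List Letter} (h : Ins (L :: xCells j k) l w) :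
    j = 0 ∧ k = 0 ∧ l = ABC.a ∧ w = L :: xCells 1 0 ∨
    (∃ m, j = m + 1 ∧ k = 0 ∧ l = ABC.a ∧ w = L :: xCells (m + 2) 0) ∨
    (∃ m, j = m + 1 ∧ l = ABC.b ∧ w = L :: xCells m (k + 1)) ∨
    (∃ m, j = 0 ∧ k = m + 1 ∧ l = ABC.c ∧ w = L :: cCells 1 0 m) := by
  have tail := fun w => @ins_xCells j k l w
  rcases j with _ | _ | j <;> rcases k with _ | k <;>
    simp only [xCells, bCells] at h <;>
    rcases h with _ | _ | _ | _ | _ | _ | ⟨_, h⟩ <;>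
    first
    | simp [xCells, bCells, cCells]; done
    | (obtain ⟨m, hm, ⟨hk, rfl, rfl⟩ | ⟨rfl, rfl⟩⟩ := tail _ h <;> cases hm <;>
        simp_all [xCells, bCells])

theorem ins_cCells {i k : ℕ} {l : ABC} {w : List Letter} (h : Ins (cCells (i + 1) 0 k) l w) :
    ∃ m, k = m + 1 ∧ l = ABC.c ∧ w = cCells (i + 2) 0 m := by
  induction i generalizing w with
  | zero =>
    rcases k with _ | k <;> simp only [cCells, xCells, bCells] at h <;>
      rcases h with _ | _ | _ | _ | _ | _ | ⟨_, h⟩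
    all_goals try exact ⟨_, rfl, rfl, rfl⟩
    all_goals
      rcases h with _ | _ | _ | _ | _ | _ | ⟨_, h⟩
      rcases h with _ | _ | _ | _ | _ | _ | ⟨_, h⟩
    · exact (not_ins_bCells (k := 0) h).elim
    · exact (not_ins_bCells (k := k + 1) h).elim
  | succ i ih =>
    rw [cCells, cCells] at h
    rcases h with _ | _ | _ | _ | _ | _ | ⟨_, h⟩
    rcases h with _ | _ | _ | _ | _ | _ | ⟨_, h⟩
    rcases h with _ | _ | _ | _ | _ | _ | ⟨_, h⟩
    obtain ⟨m, rfl, rfl, rfl⟩ := ih h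
    exact ⟨m, rfl, rfl, rfl⟩

theorem ins_L_cCells {i k : ℕ} {l : ABC} {w : List Letter}
    (h : Ins (L :: cCells (i + 1) 0 k) l w) :
    ∃ m, k = m + 1 ∧ l = ABC.c ∧ w = L :: cCells (i + 2) 0 m := by
  rw [cCells] at h
  rcases h with _ | _ | _ | _ | _ | _ | ⟨_, h⟩
  obtain ⟨m, rfl, rfl, rfl⟩ := ins_cCells h
  exact ⟨m, rfl, rfl, rfl⟩

/-- The sentential forms of `sys` with their labels: no cell carries `C` while some cell is
unmarked. -/
def Reach (u : List Letter) (ls : List ABC) : Prop :=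
  ∃ i j k, (i = 0 ∨ j = 0) ∧ u = L :: cCells i j k ∧ ls = word i j k

theorem Reach.ins {u w : List Letter} {l : ABC} {ls : List ABC} (hu : Reach u ls)
    (h : Ins u l w) : Reach w (ls ++ [l]) := by
  obtain ⟨i, j, k, hij, rfl, rfl⟩ := hu
  rcases i with _ | i
  · rcases ins_L_xCells h with ⟨rfl, rfl, rfl, rfl⟩ | ⟨m, rfl, rfl, rfl, rfl⟩ |
      ⟨m, rfl, rfl, rfl⟩ | ⟨m, rfl, rfl, rfl, rfl⟩
    · exact ⟨0, 1, 0, .inl rfl, rfl, rfl⟩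
    · exact ⟨0, m + 2, 0, .inl rfl, rfl, by simp [word, List.replicate_succ']⟩
    · refine ⟨0, m, k + 1, .inl rfl, rfl, ?_⟩
      simp [word, List.replicate_succ', show m + (k + 1) = m + 1 + k by omega]
    · refine ⟨1, 0, m, .inr rfl, rfl, ?_⟩
      simp [word, Nat.add_comm]
  · obtain rfl : j = 0 := by omega
    obtain ⟨m, rfl, rfl, rfl⟩ := ins_L_cCells h
    refine ⟨i + 2, 0, m, .inr rfl, rfl, ?_⟩
    simp [word, List.replicate_succ' (n := i + 1), show i + 2 + m = i + 1 + (m + 1) by omega]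

theorem reach_of_deriv {u : List Letter} {ls : List ABC} (h : sys.Deriv u ls) : Reach u ls := by
  induction h with
  | start hx hy hr hs =>
    obtain ⟨l, hl, hi⟩ := ins_of_splice hr hy hs
    rw [hl]
    simp only [sys, Set.mem_insert_iff, Set.mem_singleton_iff] at hx
    rcases hx with rfl | rfl | rfl | rfl
    · exact Reach.ins ⟨0, 0, 0, .inl rfl, rfl, rfl⟩ hi
    all_goals rcases hi with _ | _ | _ | _ | _ | _ | ⟨_, hi⟩; cases hi
  | step _ hy hr hs ih =>
    obtain ⟨l, hl, hi⟩ := ins_of_splice hr hy hs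
    exact hl ▸ ih.ins hi

theorem ins_b (j k : ℕ) : Ins (xCells (j + 1) k) ABC.b (xCells j (k + 1)) := by
  induction j with
  | zero =>
    rcases k with _ | k
    · exact .bFirst _
    · exact .bNext _
  | succ j ih => exact ih.cons X

theorem ins_c (i k : ℕ) : Ins (L :: cCells i 0 (k + 1)) ABC.c (L :: cCells (i + 1) 0 k) := by
  rcases i with _ | i
  · exact .cFirst _
  · refine .cons _ ?_
    induction i with
    | zero => exact .cNext _
    | succ i ih => exact ((ih.cons _).cons _).cons _

theorem not_applicable {n : ℕ} : ¬ sys.Applicable (L :: cCells (n + 1) 0 0) := by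
  rw [applicable_iff]
  rintro ⟨l, w, h⟩
  obtain ⟨m, hm, -⟩ := ins_L_cCells h
  cases hm

theorem ins_a (j : ℕ) : Ins (L :: xCells j 0) ABC.a (L :: xCells (j + 1) 0) := by
  rcases j with _ | j
  · exact .aFirst _
  · refine .cons _ ?_
    induction j with
    | zero => exact .aNext _
    | succ j ih => exact ih.cons X

theorem deriv_a (j : ℕ) : sys.Deriv (L :: cCells 0 (j + 1) 0) (word 0 (j + 1) 0) := by
  induction j with
  | zero =>
    exact .start (x₀ := [L, R]) (y₀ := [X]) (r := ⟨[L], [R], [X], []⟩) (by simp [sys])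
      (by simp [sys]) (by simp [sys]) ⟨[], [], [], by simp [cCells, xCells, bCells]⟩
  | succ j ih =>
    have h := deriv_step ih (ins_a (j + 1))
    simpa [word, cCells, List.replicate_succ'] using h

theorem deriv_b {n j k : ℕ} (h : j + k = n + 1) : sys.Deriv (L :: cCells 0 j k) (word 0 j k) := by
  induction k generalizing j with
  | zero => obtain rfl : j = n + 1 := h; exact deriv_a n
  | succ k ih =>
    have h := deriv_step (ih (j := j + 1) (by omega)) ((ins_b j k).cons L)
    simpa [word, cCells, List.replicate_succ', show j + (k + 1) = j + 1 + k by omega] using h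

theorem deriv_c {n i k : ℕ} (h : i + k = n + 1) : sys.Deriv (L :: cCells i 0 k) (word i 0 k) := by
  induction i generalizing k with
  | zero => exact deriv_b h
  | succ i ih =>
    have h := deriv_step (ih (k := k + 1) (by omega)) (ins_c i k)
    simpa [word, List.replicate_succ' (n := i), show i + (k + 1) = i + 1 + k by omega] using h

theorem derLang_sys : sys.derLang = { w : List ABC | ∃ k : ℕ, 1 ≤ k ∧
    w = List.replicate k ABC.a ++ List.replicate k ABC.b ++ List.replicate k ABC.c } := by
  ext ls
  constructor
  · rintro ⟨u, hu, hn⟩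
    rw [applicable_iff] at hn
    obtain ⟨i, j, k, hij, rfl, rfl⟩ := reach_of_deriv hu
    rcases j with _ | j
    · rcases k with _ | k
      · rcases i with _ | i
        · exact (hn ⟨_, _, ins_a 0⟩).elim
        · exact ⟨i + 1, by omega, rfl⟩
      · exact (hn ⟨_, _, ins_c i k⟩).elim
    · obtain rfl : i = 0 := by omega
      exact (hn ⟨_, _, (ins_b j k).cons L⟩).elim
  · rintro ⟨_ | n, hn, rfl⟩
    · omega
    · exact ⟨_, deriv_c (k := 0) rfl, not_applicable⟩

end CountingSystem

/-- The language `{aⁿbⁿcⁿ : n ≥ 1}` is the control language of some labeled flat splicing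
system of type `(3, 1)` with finite initial set. -/
theorem stmt19 :
    ∃ (A : Type) (_ : Finite A) (S : LabeledFSS A ABC),
      S.ControlLabeled ∧ S.I.Finite ∧ S.HasType 3 1 ∧
      S.derLang = { w : List ABC | ∃ k : ℕ, 1 ≤ k ∧
        w = List.replicate k ABC.a ++ List.replicate k ABC.b ++ List.replicate k ABC.c } := by
  refine ⟨CountingSystem.Letter, inferInstance, CountingSystem.sys, ?_, ?_, ?_,
    CountingSystem.derLang_sys⟩
  · simp [LabeledFSS.ControlLabeled, CountingSystem.sys]
  · simp [CountingSystem.sys]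
  · simp [LabeledFSS.HasType, CountingSystem.sys]
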